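/- arXiv:2304.01977 — 5 statements merged into one kernel-verified Lean document; each statement's English description precedes it below -/
import Mathlib

section
/- Suppose there exists β > 0 such that every zero s ∈ ℂ of Δ_bls satisfies Re s ≤ -β, and let α > 0 be such that every zero s ∈ ℂ of Δ_ros satisfies Re s < -α. Then there exists ε* > 0 such that, for every ε with 0 < ε ≤ ε*, every zero s ∈ ℂ of the function s ↦ Δ_full(s, ε) satisfies Re s < -α. -/
open Matrix Complex

/-- `E(w) = diag(e^{-w/λ₁}, …, e^{-w/λ_m})`. -/
noncomputable def Emat {m : ℕ} (lam : Fin m → ℝ) (w : ℂ) : Matrix (Fin m) (Fin m) ℂ :=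
  Matrix.diagonal (fun i => Complex.exp (-w / (lam i : ℂ)))

/-- Characteristic function of the boundary-layer system: `Δ_bls(s) = det(I − E(s) G₁)`. -/
noncomputable def Δbls {m : ℕ} (lam : Fin m → ℝ) (G₁ : Matrix (Fin m) (Fin m) ℝ) (s : ℂ) : ℂ :=
  (1 - Emat lam s * G₁.map Complex.ofReal).det

/-- Characteristic function of the reduced order system:
`Δ_ros(s) = det(s I − A − B (I − G₁)⁻¹ G₂)`. -/
noncomputable def Δros {n m : ℕ} (A : Matrix (Fin n) (Fin n) ℝ) (B : Matrix (Fin n) (Fin m) ℝ)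
    (G₁ : Matrix (Fin m) (Fin m) ℝ) (G₂ : Matrix (Fin m) (Fin n) ℝ) (s : ℂ) : ℂ :=
  (s • (1 : Matrix (Fin n) (Fin n) ℂ) - A.map Complex.ofReal
    - B.map Complex.ofReal * (1 - G₁.map Complex.ofReal)⁻¹ * G₂.map Complex.ofReal).det

/-- The block matrix `M(s, ε)`. -/
noncomputable def Mfull {n m : ℕ} (A : Matrix (Fin n) (Fin n) ℝ) (B : Matrix (Fin n) (Fin m) ℝ)
    (G₁ : Matrix (Fin m) (Fin m) ℝ) (G₂ : Matrix (Fin m) (Fin n) ℝ) (lam : Fin m → ℝ)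
    (s : ℂ) (ε : ℝ) : Matrix (Fin n ⊕ Fin m) (Fin n ⊕ Fin m) ℂ :=
  Matrix.fromBlocks
    (s • (1 : Matrix (Fin n) (Fin n) ℂ) - A.map Complex.ofReal)
    (B.map Complex.ofReal * Emat lam ((ε : ℂ) * s))
    (G₂.map Complex.ofReal)
    (1 - G₁.map Complex.ofReal * Emat lam ((ε : ℂ) * s))

/-- Characteristic function of the full system: `Δ_full(s, ε) = det M(s, ε)`. -/
noncomputable def Δfull {n m : ℕ} (A : Matrix (Fin n) (Fin n) ℝ) (B : Matrix (Fin n) (Fin m) ℝ)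
    (G₁ : Matrix (Fin m) (Fin m) ℝ) (G₂ : Matrix (Fin m) (Fin n) ℝ) (lam : Fin m → ℝ)
    (s : ℂ) (ε : ℝ) : ℂ :=
  (Mfull A B G₁ G₂ lam s ε).det

open Filter Topology Metric

/-- Hurwitz-type persistence of zeros: an isolated zero at `z₀` of one member of a continuous
family of entire functions persists near `z₀` for all nearby members. -/
lemma eventually_exists_zero_mem_closedBall {X : Type*} [TopologicalSpace X] {F : X → ℂ → ℂ}
    (hF : Continuous fun p : X × ℂ => F p.1 p.2) (hd : ∀ x, Differentiable ℂ (F x))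
    {x₀ : X} {z₀ : ℂ} (h₀ : F x₀ z₀ = 0) (hne : ∃ z, F x₀ z ≠ 0) {r : ℝ} (hr : 0 < r) :
    ∀ᶠ x in 𝓝 x₀, ∃ z ∈ closedBall z₀ r, F x z = 0 := by
  have han : AnalyticOnNhd ℂ (F x₀) Set.univ := fun z _ => (hd x₀).analyticAt z
  have hev : ∀ᶠ z in 𝓝[≠] z₀, F x₀ z ≠ 0 := by
    refine (han z₀ trivial).eventually_eq_zero_or_eventually_ne_zero.resolve_left fun h => ?_
    obtain ⟨z, hz⟩ := hne
    exact hz (han.eqOn_zero_of_preconnected_of_eventuallyEq_zero isPreconnected_univ trivial h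
      trivial)
  rw [eventually_nhdsWithin_iff, Metric.eventually_nhds_iff] at hev
  obtain ⟨δ, hδ, hev⟩ := hev
  set ρ := min r (δ / 2)
  have hρ₀ : 0 < ρ := lt_min hr (half_pos hδ)
  have hsph : ∀ z ∈ sphere z₀ ρ, F x₀ z ≠ 0 := fun z hz => by
    rw [mem_sphere] at hz
    refine hev ?_ fun h => ?_
    · have := min_le_right r (δ / 2)
      linarith
    · rw [Set.mem_singleton_iff.1 h, dist_self] at hz
      exact hρ₀.ne hz
  have hcx : Continuous (F x₀) := (hd x₀).continuous
  obtain ⟨μ, hμ, hμF⟩ : ∃ μ > 0, ∀ z ∈ sphere z₀ ρ, μ < ‖F x₀ z‖ := by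
    obtain ⟨w, hw, hmin⟩ := (isCompact_sphere z₀ ρ).exists_isMinOn
      (NormedSpace.sphere_nonempty.2 hρ₀.le) hcx.norm.continuousOn
    have hw₀ := norm_pos_iff.2 (hsph w hw)
    exact ⟨‖F x₀ w‖ / 2, half_pos hw₀, fun z hz => (half_lt_self hw₀).trans_le (hmin hz)⟩
  have h₁ : ∀ᶠ x in 𝓝 x₀, ∀ z ∈ sphere z₀ ρ, μ < ‖F x z‖ :=
    (isCompact_sphere z₀ ρ).eventually_forall_of_forall_eventually fun z hz =>
      hF.norm.continuousAt.eventually_const_lt (hμF z hz)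
  have h₂ : ∀ᶠ x in 𝓝 x₀, ‖F x z₀‖ < μ := by
    have hc : Continuous fun x => F x z₀ := hF.comp (by fun_prop : Continuous fun x : X => (x, z₀))
    exact hc.norm.continuousAt.eventually_lt_const (by simpa [h₀] using hμ)
  filter_upwards [h₁, h₂] with x hx₁ hx₂
  by_contra! hz
  have hz' : ∀ z ∈ closedBall z₀ ρ, F x z ≠ 0 := fun z h =>
    hz z (closedBall_subset_closedBall (min_le_left _ _) h)
  have hcl : closure (ball z₀ ρ) = closedBall z₀ ρ := closure_ball z₀ hρ₀.ne'
  have hdc : DiffContOnCl ℂ (F x)⁻¹ (ball z₀ ρ) :=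
    (hd x).diffContOnCl.inv fun z h => hz' z (hcl ▸ h)
  have hle : ‖(F x)⁻¹ z₀‖ ≤ μ⁻¹ := by
    refine Complex.norm_le_of_forall_mem_frontier_norm_le isBounded_ball hdc (fun z h => ?_)
      (subset_closure (mem_ball_self hρ₀))
    rw [frontier_ball z₀ hρ₀.ne'] at h
    rw [Pi.inv_apply, norm_inv]
    exact inv_anti₀ hμ (hx₁ z h).le
  rw [Pi.inv_apply, norm_inv] at hle
  have hpos : 0 < ‖F x z₀‖ := norm_pos_iff.2 (hz' z₀ (mem_closedBall_self hρ₀.le))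
  exact absurd ((inv_le_inv₀ hpos hμ).1 hle) (not_le.2 hx₂)

lemma Δbls_eq {m : ℕ} (lam : Fin m → ℝ) (G₁ : Matrix (Fin m) (Fin m) ℝ) (s : ℂ) :
    Δbls lam G₁ s = (1 - G₁.map Complex.ofReal * Emat lam s).det :=
  det_one_sub_mul_comm _ _

/-- The set of delay vectors `(e^{-w/λᵢ})ᵢ` with `w` in the half plane `Re w ≥ -b`. -/
def delaySet {m : ℕ} (lam : Fin m → ℝ) (b : ℝ) : Set (Fin m → ℂ) :=
  (fun w i => Complex.exp (-w / (lam i : ℂ))) '' {w : ℂ | -b ≤ w.re}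

lemma isCompact_closure_delaySet {m : ℕ} {lam : Fin m → ℝ} (hlam : ∀ i, 0 < lam i) (b : ℝ) :
    IsCompact (closure (delaySet lam b)) := by
  refine Bornology.IsBounded.isCompact_closure ?_
  refine (Bornology.IsBounded.pi fun i =>
    isBounded_closedBall (x := (0 : ℂ)) (r := Real.exp (b / lam i))).subset ?_
  rintro _ ⟨w, hw, rfl⟩ i -
  rw [mem_closedBall_zero_iff, Complex.norm_exp, Real.exp_le_exp, Complex.div_ofReal_re,
    Complex.neg_re]
  exact div_le_div_of_nonneg_right (neg_le.1 hw) (hlam i).le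

lemma tendsto_exp_neg_div_atTop {l : ℝ} (hl : 0 < l) :
    Tendsto (fun x : ℝ => Complex.exp (-(x : ℂ) / (l : ℂ))) atTop (𝓝 0) := by
  rw [tendsto_zero_iff_norm_tendsto_zero]
  simp only [Complex.norm_exp, Complex.div_ofReal_re, Complex.neg_re, Complex.ofReal_re, neg_div]
  exact Real.tendsto_exp_neg_atTop_nhds_zero.comp (tendsto_id.atTop_div_const hl)

/-- Spectral stability of the boundary layer gives a uniform spectral gap: the limits of
`I - G₁ E(w)`, with `w` in a slightly smaller half plane, are nonsingular. -/
lemma det_ne_zero_of_mem_closure_delaySet {m : ℕ} {lam : Fin m → ℝ} (hlam : ∀ i, 0 < lam i)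
    {G₁ : Matrix (Fin m) (Fin m) ℝ} {b β : ℝ} (hb : b < β)
    (hβ : ∀ s : ℂ, Δbls lam G₁ s = 0 → s.re ≤ -β) {d : Fin m → ℂ}
    (hd : d ∈ closure (delaySet lam b)) :
    (1 - G₁.map Complex.ofReal * diagonal d).det ≠ 0 := by
  intro h₀
  let F : (Fin m → ℂ) → ℂ → ℂ := fun d z =>
    (1 - G₁.map Complex.ofReal * diagonal fun i => d i * Complex.exp (-z / (lam i : ℂ))).det
  have hF : Continuous fun p : (Fin m → ℂ) × ℂ => F p.1 p.2 := by
    refine Continuous.matrix_det (continuous_const.sub (continuous_const.matrix_mul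
      (Continuous.matrix_diagonal ?_)))
    fun_prop
  have hdiff : ∀ d, Differentiable ℂ (F d) := fun d => by
    simp only [F, Matrix.det_apply, Matrix.sub_apply, Matrix.mul_diagonal]
    fun_prop
  have hne : ∃ z, F d z ≠ 0 := by
    have hlim : Tendsto (fun x : ℝ => F d x) atTop (𝓝 1) := by
      have hc : Continuous fun v : Fin m → ℂ =>
          (1 - G₁.map Complex.ofReal * diagonal fun i => d i * v i).det := by
        refine Continuous.matrix_det (continuous_const.sub (continuous_const.matrix_mul
          (Continuous.matrix_diagonal ?_)))
        fun_prop
      have := (hc.tendsto 0).comp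
        (tendsto_pi_nhds.2 fun i => tendsto_exp_neg_div_atTop (hlam i))
      simpa [Function.comp_def] using this
    obtain ⟨x, hx⟩ := (hlim.eventually_ne one_ne_zero).exists
    exact ⟨x, hx⟩
  have hr : 0 < (β - b) / 2 := by linarith
  have hev := eventually_exists_zero_mem_closedBall hF hdiff (z₀ := 0)
    (by simpa [F] using h₀) hne hr
  obtain ⟨_, ⟨z, hz, hFz⟩, w, hw, rfl⟩ := mem_closure_iff_nhds.1 hd _ hev
  have hzero : Δbls lam G₁ (w + z) = 0 := by
    rw [Δbls_eq, ← hFz]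
    simp only [F, Emat, ← Complex.exp_add, neg_add, add_div]
  have h₁ := hβ _ hzero
  have h₂ : |z.re| ≤ (β - b) / 2 := (Complex.abs_re_le_norm z).trans (by simpa using hz)
  have h₃ : -b ≤ w.re := hw
  rw [Complex.add_re] at h₁
  linarith [neg_abs_le z.re]

lemma isUnit_one_sub_map_ofReal {m : ℕ} {G₁ : Matrix (Fin m) (Fin m) ℝ} (hG₁ : IsUnit (1 - G₁)) :
    IsUnit (1 - G₁.map Complex.ofReal) := by
  have h := hG₁.map (Complex.ofRealHom.mapMatrix (m := Fin m))
  rwa [map_sub, map_one] at h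

section

variable {n m : ℕ} (A : Matrix (Fin n) (Fin n) ℝ) (B : Matrix (Fin n) (Fin m) ℝ)
  (G₁ : Matrix (Fin m) (Fin m) ℝ) (G₂ : Matrix (Fin m) (Fin n) ℝ) (lam : Fin m → ℝ)

/-- A uniform a priori bound on the zeros of `Δfull` over a compact set of delay vectors. -/
lemma exists_norm_bound_of_det_eq_zero {K : Set (Fin m → ℂ)} (hK : IsCompact K)
    (hdet : ∀ d ∈ K, (1 - G₁.map Complex.ofReal * diagonal d).det ≠ 0) :
    ∃ R : ℝ, ∀ s : ℂ, ∀ d ∈ K,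
      (fromBlocks (s • (1 : Matrix (Fin n) (Fin n) ℂ) - A.map Complex.ofReal)
        (B.map Complex.ofReal * diagonal d) (G₂.map Complex.ofReal)
        (1 - G₁.map Complex.ofReal * diagonal d)).det = 0 → ‖s‖ ≤ R := by
  have hc : Continuous fun p : ℂ × (Fin m → ℂ) =>
      (fromBlocks ((1 : Matrix (Fin n) (Fin n) ℂ) - p.1 • A.map Complex.ofReal)
        (p.1 • (B.map Complex.ofReal * diagonal p.2)) (G₂.map Complex.ofReal)
        (1 - G₁.map Complex.ofReal * diagonal p.2)).det := by
    fun_prop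
  have hev := hK.eventually_forall_of_forall_eventually (x₀ := (0 : ℂ))
    (P := fun z d => (fromBlocks ((1 : Matrix (Fin n) (Fin n) ℂ) - z • A.map Complex.ofReal)
        (z • (B.map Complex.ofReal * diagonal d)) (G₂.map Complex.ofReal)
        (1 - G₁.map Complex.ofReal * diagonal d)).det ≠ 0) fun d hd =>
      hc.continuousAt.eventually_ne (by simpa using hdet d hd)
  obtain ⟨r, hr, hev⟩ := Metric.eventually_nhds_iff.1 hev
  refine ⟨r⁻¹, fun s d hd h => ?_⟩
  by_contra! hs
  have hs₀ : s ≠ 0 := norm_pos_iff.1 ((inv_pos.2 hr).trans hs)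
  refine hev (y := s⁻¹) ?_ d hd ?_
  · rw [dist_zero_right, norm_inv]
    exact inv_lt_of_inv_lt₀ hr hs
  · have hmul : fromBlocks ((1 : Matrix (Fin n) (Fin n) ℂ) - s⁻¹ • A.map Complex.ofReal)
        (s⁻¹ • (B.map Complex.ofReal * diagonal d)) (G₂.map Complex.ofReal)
        (1 - G₁.map Complex.ofReal * diagonal d) =
        fromBlocks (s⁻¹ • (1 : Matrix (Fin n) (Fin n) ℂ)) 0 0 (1 : Matrix (Fin m) (Fin m) ℂ) *
        fromBlocks (s • (1 : Matrix (Fin n) (Fin n) ℂ) - A.map Complex.ofReal)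
          (B.map Complex.ofReal * diagonal d) (G₂.map Complex.ofReal)
          (1 - G₁.map Complex.ofReal * diagonal d) := by
      simp [fromBlocks_multiply, smul_sub, smul_smul, hs₀]
    rw [hmul, det_mul, h, mul_zero]

lemma continuous_Δfull : Continuous fun p : ℝ × ℂ => Δfull A B G₁ G₂ lam p.2 p.1 := by
  unfold Δfull Mfull Emat
  fun_prop

lemma Δfull_zero (hG₁ : IsUnit (1 - G₁)) (s : ℂ) :
    Δfull A B G₁ G₂ lam s 0 =
      (1 - G₁.map Complex.ofReal).det * Δros A B G₁ G₂ s := by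
  have := (isUnit_one_sub_map_ofReal hG₁).invertible
  simp [Δfull, Mfull, Emat, Δros, det_fromBlocks₂₂, invOf_eq_nonsing_inv]

end

theorem stmt0 {n m : ℕ} (hn : 0 < n) (hm : 0 < m)
    (A : Matrix (Fin n) (Fin n) ℝ) (B : Matrix (Fin n) (Fin m) ℝ)
    (G₁ : Matrix (Fin m) (Fin m) ℝ) (G₂ : Matrix (Fin m) (Fin n) ℝ)
    (lam : Fin m → ℝ) (hlam : ∀ i, 0 < lam i)
    (hG₁ : IsUnit (1 - G₁))
    (hbls : ∃ β > (0 : ℝ), ∀ s : ℂ, Δbls lam G₁ s = 0 → s.re ≤ -β)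
    (α : ℝ) (hα : 0 < α)
    (hros : ∀ s : ℂ, Δros A B G₁ G₂ s = 0 → s.re < -α) :
    ∃ εstar > (0 : ℝ), ∀ ε : ℝ, 0 < ε → ε ≤ εstar →
      ∀ s : ℂ, Δfull A B G₁ G₂ lam s ε = 0 → s.re < -α := by
  obtain ⟨β, hβ, hbls⟩ := hbls
  obtain ⟨R, hR⟩ := exists_norm_bound_of_det_eq_zero A B G₁ G₂
    (isCompact_closure_delaySet hlam (β / 2))
    fun d hd => det_ne_zero_of_mem_closure_delaySet hlam (half_lt_self hβ) hbls hd
  have hC : IsCompact (closedBall (0 : ℂ) R ∩ {s | -α ≤ s.re}) :=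
    (isCompact_closedBall 0 R).inter_right (isClosed_le continuous_const Complex.continuous_re)
  have hev := hC.eventually_forall_of_forall_eventually (x₀ := (0 : ℝ))
    (P := fun ε s => Δfull A B G₁ G₂ lam s ε ≠ 0) fun s hs =>
      (continuous_Δfull A B G₁ G₂ lam).continuousAt.eventually_ne <| by
        rw [Δfull_zero A B G₁ G₂ lam hG₁]
        exact mul_ne_zero ((isUnit_iff_isUnit_det _).1 (isUnit_one_sub_map_ofReal hG₁)).ne_zero
          fun h => (hros s h).not_ge hs.2
  obtain ⟨δ, hδ, hev⟩ := Metric.eventually_nhds_iff.1 hev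
  refine ⟨min (δ / 2) (β / 2 / α), by positivity, fun ε hε hle s hs => ?_⟩
  by_contra! hre
  have hεα : ε * α ≤ β / 2 := (le_div_iff₀ hα).1 (hle.trans (min_le_right _ _))
  have hmem : (fun i => Complex.exp (-((ε : ℂ) * s) / (lam i : ℂ))) ∈
      closure (delaySet lam (β / 2)) := by
    refine subset_closure ⟨(ε : ℂ) * s, ?_, rfl⟩
    rw [Set.mem_ofPred_eq, Complex.re_ofReal_mul]
    nlinarith
  refine hev (y := ε) ?_ s ⟨mem_closedBall_zero_iff.2 (hR s _ hmem hs), hre⟩ hs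
  rw [dist_zero_right, Real.norm_of_nonneg hε.le]
  exact (hle.trans (min_le_left _ _)).trans_lt (half_lt_self hδ)
end

section
/- Let G₁ be an m × m matrix with real entries and Λ an m × m diagonal matrix with positive diagonal entries. The following assertions are equivalent: (1) there exist μ > 0 and an m × m diagonal matrix Q with positive diagonal entries such that e^{-μ} Q Λ − G₁ᵀ Q Λ G₁ is positive definite; (2) there exists an m × m diagonal matrix D with positive diagonal entries such that ‖D G₁ D^{-1}‖₂ < 1, where ‖·‖₂ denotes the operator norm on real m × m matrices induced by the Euclidean norm on ℝ^m. -/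
open Matrix

/-- Operator norm on real `m × m` matrices induced by the Euclidean norm on `ℝ^m`. -/
noncomputable def opNorm2 {m : ℕ} (M : Matrix (Fin m) (Fin m) ℝ) : ℝ :=
  ‖LinearMap.toContinuousLinearMap (Matrix.toEuclideanLin M)‖

/-- Bounding the operator norm of `D G D⁻¹` amounts to bounding `G` in the norm weighted by `D`. -/
theorem opNorm2_diagonal_conj_le_iff {m : ℕ} (G : Matrix (Fin m) (Fin m) ℝ) {d : Fin m → ℝ}
    (hd : ∀ i, 0 < d i) {c : ℝ} (hc : 0 ≤ c) :
    opNorm2 (diagonal d * G * (diagonal d)⁻¹) ≤ c ↔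
      ∀ x : Fin m → ℝ, ∑ i, (d i * (G *ᵥ x) i) ^ 2 ≤ c ^ 2 * ∑ i, (d i * x i) ^ 2 := by
  have hunit : IsUnit (diagonal d).det := by
    rw [det_diagonal]
    exact (Finset.prod_pos fun i _ => hd i).ne'.isUnit
  have hnorm : ∀ x : Fin m → ℝ,
      (‖(toEuclideanLin (diagonal d * G * (diagonal d)⁻¹)) (WithLp.toLp 2 (diagonal d *ᵥ x))‖
          ≤ c * ‖(WithLp.toLp 2 (diagonal d *ᵥ x) : EuclideanSpace ℝ (Fin m))‖) ↔
        ∑ i, (d i * (G *ᵥ x) i) ^ 2 ≤ c ^ 2 * ∑ i, (d i * x i) ^ 2 := by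
    intro x
    have hmul : (diagonal d * G * (diagonal d)⁻¹) *ᵥ (diagonal d *ᵥ x)
        = diagonal d *ᵥ (G *ᵥ x) := by
      rw [mulVec_mulVec, Matrix.nonsing_inv_mul_cancel_right _ _ hunit, mulVec_mulVec]
    rw [← sq_le_sq₀ (norm_nonneg _) (by positivity), mul_pow, EuclideanSpace.real_norm_sq_eq,
      EuclideanSpace.real_norm_sq_eq, toLpLin_toLp, toLin'_apply, hmul]
    simp only [mulVec_diagonal]
  unfold opNorm2
  rw [ContinuousLinearMap.opNorm_le_iff hc]
  constructor
  · intro h x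
    exact (hnorm x).1 (h _)
  · intro h y
    have hy := (hnorm ((diagonal d)⁻¹ *ᵥ WithLp.ofLp y)).2 (h _)
    rw [mulVec_mulVec, Matrix.mul_nonsing_inv _ hunit, one_mulVec] at hy
    exact hy

/-- Positive definiteness of `r Q Λ - Gᵀ Q Λ G` as an inequality between weighted sums. -/
theorem posDef_smul_diagonal_sub_iff {m : ℕ} (G : Matrix (Fin m) (Fin m) ℝ)
    {q l d : Fin m → ℝ} (hd : ∀ i, q i * l i = d i ^ 2) (r : ℝ) :
    (r • (diagonal q * diagonal l) - Gᵀ * diagonal q * diagonal l * G).PosDef ↔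
      ∀ x : Fin m → ℝ, x ≠ 0 →
        ∑ i, (d i * (G *ᵥ x) i) ^ 2 < r * ∑ i, (d i * x i) ^ 2 := by
  have hprod : diagonal q * diagonal l = diagonal fun i => d i ^ 2 := by
    simp only [diagonal_mul_diagonal, hd]
  have hform : ∀ x : Fin m → ℝ,
      star x ⬝ᵥ ((r • (diagonal q * diagonal l) - Gᵀ * diagonal q * diagonal l * G) *ᵥ x)
        = r * ∑ i, (d i * x i) ^ 2 - ∑ i, (d i * (G *ᵥ x) i) ^ 2 := by
    intro x
    have hdiag : ∀ y : Fin m → ℝ,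
        y ⬝ᵥ ((diagonal fun i => d i ^ 2) *ᵥ y) = ∑ i, (d i * y i) ^ 2 := by
      intro y
      simp only [dotProduct, mulVec_diagonal]
      exact Finset.sum_congr rfl fun i _ => by ring
    rw [Matrix.mul_assoc Gᵀ, hprod, star_trivial, sub_mulVec, dotProduct_sub, smul_mulVec,
      dotProduct_smul, hdiag, ← mulVec_mulVec, ← mulVec_mulVec, dotProduct_mulVec x Gᵀ,
      vecMul_transpose, hdiag, smul_eq_mul]
  rw [posDef_iff_dotProduct_mulVec]
  simp only [hform, sub_pos]
  refine ⟨fun h x hx => h.2 hx, fun h => ⟨?_, fun x hx => h x hx⟩⟩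
  rw [Matrix.mul_assoc Gᵀ, hprod]
  simp [IsHermitian, Matrix.mul_assoc]

theorem stmt4 {m : ℕ} (hm : 0 < m)
    (G₁ : Matrix (Fin m) (Fin m) ℝ) (lam : Fin m → ℝ) (hlam : ∀ i, 0 < lam i) :
    (∃ μ > (0 : ℝ), ∃ q : Fin m → ℝ, (∀ i, 0 < q i) ∧
      (Real.exp (-μ) • (Matrix.diagonal q * Matrix.diagonal lam)
        - G₁ᵀ * Matrix.diagonal q * Matrix.diagonal lam * G₁).PosDef)
    ↔ (∃ d : Fin m → ℝ, (∀ i, 0 < d i) ∧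
      opNorm2 (Matrix.diagonal d * G₁ * (Matrix.diagonal d)⁻¹) < 1) := by
  constructor
  · rintro ⟨μ, hμ, q, hq, hpos⟩
    have hql : ∀ i, 0 < q i * lam i := fun i => mul_pos (hq i) (hlam i)
    have hd : ∀ i, 0 < √(q i * lam i) := fun i => Real.sqrt_pos.2 (hql i)
    rw [posDef_smul_diagonal_sub_iff G₁ (fun i => (Real.sq_sqrt (hql i).le).symm)] at hpos
    refine ⟨fun i => √(q i * lam i), hd, ?_⟩
    have hlt : Real.exp (-μ / 2) < 1 := Real.exp_lt_one_iff.2 (by linarith)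
    refine lt_of_le_of_lt ?_ hlt
    rw [opNorm2_diagonal_conj_le_iff G₁ hd (Real.exp_pos _).le]
    intro x
    rcases eq_or_ne x 0 with rfl | hx
    · simp
    · have hsq : Real.exp (-μ / 2) ^ 2 = Real.exp (-μ) := by
        rw [← Real.exp_nat_mul]
        congr 1
        push_cast
        ring
      rw [hsq]
      exact (hpos x hx).le
  · rintro ⟨d, hd, hlt⟩
    set c := opNorm2 (diagonal d * G₁ * (diagonal d)⁻¹) with hc
    have hc0 : 0 ≤ c := norm_nonneg _
    have hbound := (opNorm2_diagonal_conj_le_iff G₁ hd hc0).1 hc.ge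
    have hc1 : c ^ 2 < 1 := by nlinarith
    have hr0 : 0 < (c ^ 2 + 1) / 2 := by positivity
    refine ⟨-Real.log ((c ^ 2 + 1) / 2), neg_pos.2 (Real.log_neg hr0 (by linarith)),
      fun i => d i ^ 2 / lam i, fun i => div_pos (pow_pos (hd i) 2) (hlam i), ?_⟩
    rw [neg_neg, Real.exp_log hr0,
      posDef_smul_diagonal_sub_iff G₁ (fun i => div_mul_cancel₀ _ (hlam i).ne')]
    intro x hx
    obtain ⟨i, hi⟩ := Function.ne_iff.1 hx
    have hsum : 0 < ∑ i, (d i * x i) ^ 2 :=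
      Finset.sum_pos' (fun _ _ => sq_nonneg _)
        ⟨i, Finset.mem_univ i, sq_pos_of_ne_zero (mul_ne_zero (hd i).ne' hi)⟩
    exact (hbound x).trans_lt (mul_lt_mul_of_pos_right (by linarith) hsum)
end

section
/- Let f : ℂ → ℂ be defined by f(s) = 1 − e^{-s} + (1/2) e^{-2s}. Then the set of zeros of f is exactly { -（1/2）ln 2 + i (π/4 + 2kπ) : k ∈ ℤ } ∪ { -(1/2) ln 2 + i (−π/4 + 2kπ) : k ∈ ℤ }. In particular, every zero s of f satisfies Re s = -(1/2) ln 2, and f equals the characteristic function Δ_bls associated with G₁ = [[1, −2], [1/4, −1/2]] and Λ = diag(1, 1/2). -/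
open Matrix Complex Real

theorem Real.exp_neg_half_log_two : Real.exp (-(1 / 2 : ℝ) * Real.log 2) = √2 / 2 := by
  rw [mul_comm, ← Real.rpow_def_of_pos two_pos, Real.rpow_neg two_pos.le, ← Real.sqrt_eq_rpow,
    Real.sqrt_div_self', one_div]

theorem Complex.exp_neg_half_log_two_add_I_mul (t : ℝ) :
    Complex.exp ((-(1 / 2 : ℝ) * Real.log 2 : ℝ) + Complex.I * (t : ℂ)) =
      ((√2 / 2 * Real.cos t : ℝ) : ℂ) + ((√2 / 2 * Real.sin t : ℝ) : ℂ) * Complex.I := by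
  rw [Complex.exp_add, ← Complex.ofReal_exp, Real.exp_neg_half_log_two, mul_comm Complex.I,
    Complex.exp_mul_I]
  push_cast
  ring

theorem sqrt_two_div_two_mul_self : √2 / 2 * (√2 / 2) = 1 / 2 := by
  nlinarith [Real.mul_self_sqrt (zero_le_two (α := ℝ))]

theorem one_sub_exp_neg_add_half_exp_neg_two_mul_eq_zero_iff (s : ℂ) :
    1 - Complex.exp (-s) + (1 / 2) * Complex.exp (-(2 * s)) = 0 ↔
      Complex.exp s = (1 / 2 : ℝ) + (1 / 2 : ℝ) * Complex.I ∨
        Complex.exp s = (1 / 2 : ℝ) + (-(1 / 2) : ℝ) * Complex.I := by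
  have hz : Complex.exp s ≠ 0 := Complex.exp_ne_zero s
  have hf : 1 - Complex.exp (-s) + (1 / 2) * Complex.exp (-(2 * s)) =
      (Complex.exp s - ((1 / 2 : ℝ) + (1 / 2 : ℝ) * Complex.I)) *
        (Complex.exp s - ((1 / 2 : ℝ) + (-(1 / 2) : ℝ) * Complex.I)) / Complex.exp s ^ 2 := by
    rw [Complex.exp_neg, Complex.exp_neg, two_mul, Complex.exp_add]
    push_cast
    field_simp
    linear_combination Complex.I_sq
  rw [hf, div_eq_zero_iff, mul_eq_zero, sub_eq_zero, sub_eq_zero]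
  simp [hz]

theorem Complex.exp_eq_exp_add_I_mul_ofReal_iff (a t : ℝ) (s : ℂ) :
    Complex.exp s = Complex.exp (a + Complex.I * (t : ℂ)) ↔
      ∃ k : ℤ, s = (a : ℂ) + Complex.I * ((t + 2 * (k : ℝ) * π : ℝ) : ℂ) := by
  rw [Complex.exp_eq_exp_iff_exists_int]
  refine exists_congr fun k => ?_
  push_cast
  ring_nf

theorem one_sub_exp_neg_add_half_exp_neg_two_mul_zeros (s : ℂ) :
    1 - Complex.exp (-s) + (1 / 2) * Complex.exp (-(2 * s)) = 0 ↔
      ((∃ k : ℤ, s = (↑(-(1 / 2 : ℝ) * Real.log 2) : ℂ)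
          + Complex.I * ((π / 4 + 2 * (k : ℝ) * π : ℝ) : ℂ)) ∨
       (∃ k : ℤ, s = (↑(-(1 / 2 : ℝ) * Real.log 2) : ℂ)
          + Complex.I * ((-(π / 4) + 2 * (k : ℝ) * π : ℝ) : ℂ))) := by
  rw [one_sub_exp_neg_add_half_exp_neg_two_mul_eq_zero_iff,
    ← Complex.exp_eq_exp_add_I_mul_ofReal_iff,
    ← Complex.exp_eq_exp_add_I_mul_ofReal_iff,
    Complex.exp_neg_half_log_two_add_I_mul, Complex.exp_neg_half_log_two_add_I_mul,
    Real.cos_neg, Real.sin_neg, Real.cos_pi_div_four, Real.sin_pi_div_four, mul_neg,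
    sqrt_two_div_two_mul_self]

theorem stmt11 :
    (∀ s : ℂ, 1 - Complex.exp (-s) + (1 / 2) * Complex.exp (-(2 * s)) = 0 ↔
      ((∃ k : ℤ, s = (↑(-(1 / 2 : ℝ) * Real.log 2) : ℂ)
          + Complex.I * ((π / 4 + 2 * (k : ℝ) * π : ℝ) : ℂ)) ∨
       (∃ k : ℤ, s = (↑(-(1 / 2 : ℝ) * Real.log 2) : ℂ)
          + Complex.I * ((-(π / 4) + 2 * (k : ℝ) * π : ℝ) : ℂ)))) ∧
    (∀ s : ℂ, 1 - Complex.exp (-s) + (1 / 2) * Complex.exp (-(2 * s)) = 0 →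
      s.re = -(1 / 2 : ℝ) * Real.log 2) ∧
    (∀ s : ℂ, 1 - Complex.exp (-s) + (1 / 2) * Complex.exp (-(2 * s))
      = Δbls ![1, 1 / 2] !![1, -2; 1 / 4, -(1 / 2)] s) := by
  refine ⟨one_sub_exp_neg_add_half_exp_neg_two_mul_zeros, fun s hs => ?_, fun s => ?_⟩
  · rcases (one_sub_exp_neg_add_half_exp_neg_two_mul_zeros s).1 hs with ⟨k, rfl⟩ | ⟨k, rfl⟩ <;>
      rw [Complex.add_re, Complex.re_mul_ofReal, Complex.I_re, zero_mul, add_zero,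
        Complex.ofReal_re]
  · simp [Δbls, Emat, Matrix.det_fin_two, Matrix.diagonal_mul]
    ring_nf
end

section
/- Let G₁ = [[1, −2], [1/4, −1/2]] ∈ ℝ^{2×2}. For every 2 × 2 diagonal matrix D = diag(d₁, d₂) with d₁, d₂ > 0, setting δ = d₁/d₂, the matrix D^{-1} G₁ᵀ D² G₁ D^{-1} has eigenvalues 0 and 5/4 + 4δ² + 1/(16δ²), and ‖D G₁ D^{-1}‖₂² = 5/4 + 4δ² + 1/(16δ²) > 1, where ‖·‖₂ denotes the operator norm induced by the Euclidean norm on ℝ². In particular, there exists no diagonal D with positive diagonal entries such that ‖D G₁ D^{-1}‖₂ < 1. -/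
open Matrix

/-- The Euclidean operator norm of an outer product is the product of the Euclidean norms. -/
theorem opNorm2_vecMulVec {m : ℕ} (u v : Fin m → ℝ) :
    opNorm2 (vecMulVec u v) = ‖WithLp.toLp 2 u‖ * ‖WithLp.toLp 2 v‖ := by
  rw [opNorm2, ← InnerProductSpace.norm_rankOne (𝕜 := ℝ)]
  congr 1
  ext x i
  simp [vecMulVec_mulVec, PiLp.inner_apply, dotProduct, mul_comm]

/-- A singular `2 × 2` matrix has eigenvalues `0` and its trace. -/
theorem Matrix.spectrum_fin_two_of_det_eq_zero {K : Type*} [Field K] (A : Matrix (Fin 2) (Fin 2) K)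
    (hA : A.det = 0) : spectrum K A = {0, A.trace} := by
  ext r
  have h : (algebraMap K (Matrix (Fin 2) (Fin 2) K) r - A).det = r * (r - A.trace) := by
    rw [det_fin_two] at hA
    simp only [det_fin_two, trace_fin_two, sub_apply, algebraMap_matrix_apply]
    simp
    linear_combination hA
  rw [spectrum.mem_iff, isUnit_iff_isUnit_det, h, isUnit_iff_ne_zero, not_not, mul_eq_zero,
    sub_eq_zero, Set.mem_insert_iff, Set.mem_singleton_iff]

theorem inv_diagonal_fin_two {a b : ℝ} (ha : a ≠ 0) (hb : b ≠ 0) :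
    (diagonal ![a, b])⁻¹ = diagonal ![a⁻¹, b⁻¹] := by
  refine inv_eq_right_inv ?_
  ext i j
  fin_cases i <;> fin_cases j <;> simp [ha, hb]

theorem diagonal_conj_eq_vecMulVec {a b : ℝ} (ha : a ≠ 0) (hb : b ≠ 0) :
    diagonal ![a, b] * !![1, -2; 1/4, -(1/2)] * (diagonal ![a, b])⁻¹
      = vecMulVec ![1, 1 / (4 * (a / b))] ![1, -2 * (a / b)] := by
  rw [inv_diagonal_fin_two ha hb]
  ext i j
  fin_cases i <;> fin_cases j <;> simp [vecMulVec_apply] <;> field_simp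
  norm_num

theorem opNorm2_diagonal_conj_sq {a b : ℝ} (ha : a ≠ 0) (hb : b ≠ 0) :
    opNorm2 (diagonal ![a, b] * !![1, -2; 1/4, -(1/2)] * (diagonal ![a, b])⁻¹) ^ 2
      = 5/4 + 4 * (a/b)^2 + 1/(16 * (a/b)^2) := by
  rw [diagonal_conj_eq_vecMulVec ha hb, opNorm2_vecMulVec, mul_pow, EuclideanSpace.norm_sq_eq,
    EuclideanSpace.norm_sq_eq]
  simp only [Fin.sum_univ_two, Real.norm_eq_abs, sq_abs]
  simp
  field_simp
  ring

theorem one_lt_five_fourths_add (δ : ℝ) : 1 < 5/4 + 4 * δ^2 + 1/(16 * δ^2) := by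
  have : 0 ≤ 4 * δ^2 + 1/(16 * δ^2) := by positivity
  linarith

theorem spectrum_diagonal_conj_gram {a b : ℝ} (ha : a ≠ 0) (hb : b ≠ 0) :
    spectrum ℝ ((diagonal ![a, b])⁻¹ * (!![1, -2; 1/4, -(1/2)] : Matrix (Fin 2) (Fin 2) ℝ)ᵀ
        * (diagonal ![a, b] * diagonal ![a, b]) * !![1, -2; 1/4, -(1/2)] * (diagonal ![a, b])⁻¹)
      = ({0, 5/4 + 4 * (a/b)^2 + 1/(16 * (a/b)^2)} : Set ℝ) := by
  rw [spectrum_fin_two_of_det_eq_zero]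
  · congr 2
    rw [inv_diagonal_fin_two ha hb, trace_fin_two]
    simp [mul_apply, Fin.sum_univ_two, diagonal_apply]
    field_simp
    ring
  · have h : (!![1, -2; 1/4, -(1/2)] : Matrix (Fin 2) (Fin 2) ℝ).det = 0 := by
      norm_num [det_fin_two]
    simp only [det_mul, h, mul_zero, zero_mul]

theorem stmt12 :
    (∀ d₁ d₂ : ℝ, 0 < d₁ → 0 < d₂ →
      spectrum ℝ ((Matrix.diagonal ![d₁, d₂])⁻¹ * (!![1, -2; 1/4, -(1/2)] : Matrix (Fin 2) (Fin 2) ℝ)ᵀ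
          * (Matrix.diagonal ![d₁, d₂] * Matrix.diagonal ![d₁, d₂])
          * !![1, -2; 1/4, -(1/2)] * (Matrix.diagonal ![d₁, d₂])⁻¹)
        = ({0, 5/4 + 4 * (d₁/d₂)^2 + 1/(16 * (d₁/d₂)^2)} : Set ℝ) ∧
      opNorm2 (Matrix.diagonal ![d₁, d₂] * !![1, -2; 1/4, -(1/2)] * (Matrix.diagonal ![d₁, d₂])⁻¹) ^ 2
        = 5/4 + 4 * (d₁/d₂)^2 + 1/(16 * (d₁/d₂)^2) ∧
      1 < 5/4 + 4 * (d₁/d₂)^2 + 1/(16 * (d₁/d₂)^2)) ∧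
    ¬ ∃ d : Fin 2 → ℝ, (∀ i, 0 < d i) ∧
      opNorm2 (Matrix.diagonal d * !![1, -2; 1/4, -(1/2)] * (Matrix.diagonal d)⁻¹) < 1 := by
  refine ⟨fun a b ha hb ↦ ⟨spectrum_diagonal_conj_gram ha.ne' hb.ne',
    opNorm2_diagonal_conj_sq ha.ne' hb.ne', one_lt_five_fourths_add _⟩, ?_⟩
  rintro ⟨d, hd, hlt⟩
  rw [show d = ![d 0, d 1] by ext i; fin_cases i <;> rfl] at hlt
  have hsq := opNorm2_diagonal_conj_sq (hd 0).ne' (hd 1).ne'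
  have hle : opNorm2 (diagonal ![d 0, d 1] * !![1, -2; 1/4, -(1/2)] * (diagonal ![d 0, d 1])⁻¹) ^ 2
      ≤ 1 := pow_le_one₀ (norm_nonneg _) hlt.le
  linarith [one_lt_five_fourths_add (d 0 / d 1)]
end

section
/- Let G₁ = [[1, −2], [1/4, −1/2]] and Λ = diag(1, 1/2). Then: (i) there is no μ > 0 and no 2 × 2 diagonal matrix Q with positive diagonal entries such that e^{-μ} Q Λ − G₁ᵀ Q Λ G₁ is positive definite; yet (ii) there exists β > 0 (namely β = (1/2) ln 2) such that every zero s ∈ ℂ of Δ_bls(s) = det(I₂ − E(s) G₁) satisfies Re s ≤ -β, where E(w) = diag(e^{-w}, e^{-2w}). -/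
open Matrix Complex

theorem norm_sq_eq_two_of_one_sub_add_half_sq_eq_zero {z : ℂ} (h : 1 - z + (1/2) * z ^ 2 = 0) :
    ‖z‖ ^ 2 = 2 := by
  have hfac : (z - (1 + I)) * (z - (1 - I)) = 0 := by
    linear_combination 2 * h - I_sq
  rw [← normSq_eq_norm_sq, normSq_apply]
  rcases mul_eq_zero.mp hfac with hz | hz <;> rw [sub_eq_zero.mp hz] <;> norm_num

theorem Δbls_example_eq (s : ℂ) :
    Δbls ![1, 1/2] !![1, -2; 1/4, -(1/2)] s = 1 - exp (-s) + (1/2) * exp (-s) ^ 2 := by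
  have hexp : exp (-s / ((1/2 : ℝ) : ℂ)) = exp (-s) ^ 2 := by
    rw [← Complex.exp_nat_mul]
    congr 1
    push_cast
    ring
  have hexp' : exp (-s / ((1 : ℝ) : ℂ)) = exp (-s) := by simp
  simp only [Δbls, Emat, det_fin_two, Matrix.sub_apply, diagonal_mul, Matrix.map_apply,
    Matrix.of_apply, Matrix.cons_val', Matrix.cons_val_zero, Matrix.cons_val_one,
    Matrix.cons_val_fin_one, hexp, hexp', Matrix.one_apply]
  norm_num
  ring

theorem stmt13 :
    (¬ ∃ μ > (0 : ℝ), ∃ q : Fin 2 → ℝ, (∀ i, 0 < q i) ∧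
      (Real.exp (-μ) • (Matrix.diagonal q * Matrix.diagonal ![1, 1/2])
        - (!![1, -2; 1/4, -(1/2)] : Matrix (Fin 2) (Fin 2) ℝ)ᵀ * Matrix.diagonal q
          * Matrix.diagonal ![1, 1/2] * !![1, -2; 1/4, -(1/2)]).PosDef) ∧
    (∃ β > (0 : ℝ), β = (1/2) * Real.log 2 ∧
      ∀ s : ℂ, Δbls ![1, 1/2] !![1, -2; 1/4, -(1/2)] s = 0 → s.re ≤ -β) := by
  refine ⟨?_, (1/2) * Real.log 2, by positivity, rfl, fun s hs => ?_⟩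
  · rintro ⟨μ, hμ, q, hq, hpos⟩
    have hdiag := hpos.diag_pos (i := 0)
    have hexp : Real.exp (-μ) < 1 := Real.exp_lt_one_iff.mpr (by linarith)
    simp [Matrix.mul_apply, Fin.sum_univ_two, diagonal_apply] at hdiag
    nlinarith [hq 0, hq 1]
  · rw [Δbls_example_eq] at hs
    have hnorm := norm_sq_eq_two_of_one_sub_add_half_sq_eq_zero hs
    rw [norm_exp, neg_re] at hnorm
    have hlog := congrArg Real.log hnorm
    rw [Real.log_pow, Real.log_exp] at hlog
    push_cast at hlog
    linarith
end
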